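/- arXiv:math/0108140 — 6 statements merged into one kernel-verified Lean document; each statement's English description precedes it below -/
import Mathlib

section
/- Let k be an algebraically closed field of characteristic p > 0, let n ≥ 1, and let u ∈ GL(n, k) be a unipotent matrix (i.e. u − 1 is nilpotent) satisfying u^p = 1. Then there exists a group homomorphism φ : SL(2, k) → GL(n, k) whose image contains u. -/
theorem sub_one_pow_char_eq (k : Type*) {A : Type*} [Field k] [Ring A] [Algebra k A] (p : ℕ)
    [Fact p.Prime] [CharP k p] (x : A) : (x - 1) ^ p = x ^ p - 1 := by
  nontriviality A
  have := charP_of_injective_algebraMap (algebraMap k A).injective p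
  rw [sub_pow_char_of_commute _ (Commute.one_right x), one_pow]

open Polynomial in
/-- A nilpotent endomorphism of a space of dimension at most `m + 1` whose `m`-th power is nonzero
is a single Jordan block. -/
theorem Module.End.exists_quotient_X_pow_linearEquiv {k W : Type*} [Field k] [AddCommGroup W]
    [Module k W] [Module.Finite k W] (N : Module.End k W) (hN : IsNilpotent N) (m : ℕ)
    (hW : Module.finrank k W ≤ m + 1) (w : W) (hw : (N ^ m) w ≠ 0) :
    ∃ e : (k[X] ⧸ Ideal.span {(X : k[X]) ^ (m + 1)}) ≃ₗ[k] W,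
      ∀ q, e ((X : k[X]) • q) = N (e q) := by
  have hN0 : N ^ (m + 1) = 0 := by
    have h := LinearMap.aeval_self_charpoly N
    rw [hN.charpoly_eq_X_pow_finrank, map_pow, aeval_X] at h
    exact pow_eq_zero_of_le hW h
  let f := LinearMap.toSpanSingleton k[X] (Module.AEval' N) (Module.AEval'.of N w)
  have hX (j : ℕ) : f (X ^ j) = Module.AEval'.of N ((N ^ j) w) := by
    rw [LinearMap.toSpanSingleton_apply, Module.AEval'.X_pow_smul_of,
      Module.End.smul_def]
  have hker : LinearMap.ker f = Ideal.span {(X : k[X]) ^ (m + 1)} := by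
    obtain ⟨g, hg⟩ := IsPrincipalIdealRing.principal (LinearMap.ker f)
    have hmem : ∀ r, f r = 0 ↔ g ∣ r := fun r ↦ by
      rw [← LinearMap.mem_ker, hg]; exact Ideal.mem_span_singleton
    obtain ⟨i, hi, hgi⟩ := (dvd_prime_pow prime_X (m + 1)).1
      ((hmem (X ^ (m + 1))).1 (by rw [hX, hN0]; simp))
    have him : ¬ i ≤ m := fun h ↦ hw <| by
      have := (hmem (X ^ m)).2 (hgi.dvd.trans (pow_dvd_pow X h))
      rwa [hX, map_eq_zero_iff _ (LinearEquiv.injective _)] at this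
    obtain rfl : i = m + 1 := by omega
    rw [hg]
    exact Ideal.span_singleton_eq_span_singleton.2 hgi
  let F : (k[X] ⧸ Ideal.span {(X : k[X]) ^ (m + 1)}) →ₗ[k[X]] Module.AEval' N :=
    Submodule.liftQ _ f hker.ge
  have hF : Function.Injective F :=
    LinearMap.ker_eq_bot.1 (Submodule.ker_liftQ_eq_bot _ _ _ hker.le)
  let G : (k[X] ⧸ Ideal.span {(X : k[X]) ^ (m + 1)}) →ₗ[k] W :=
    (Module.AEval'.of N).symm.toLinearMap ∘ₗ F.restrictScalars k
  have hG : Function.Injective G := (Module.AEval'.of N).symm.injective.comp hF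
  have : Module.Finite k (k[X] ⧸ Ideal.span {(X : k[X]) ^ (m + 1)}) :=
    Module.Finite.of_injective G hG
  have hdim : Module.finrank k (k[X] ⧸ Ideal.span {(X : k[X]) ^ (m + 1)}) =
      Module.finrank k W := by
    refine le_antisymm (LinearMap.finrank_le_finrank_of_injective hG) ?_
    rwa [finrank_quotient_span_eq_natDegree, natDegree_X_pow]
  refine ⟨G.linearEquivOfInjective hG hdim, fun q ↦ ?_⟩
  change (Module.AEval'.of N).symm (F ((X : k[X]) • q)) = N ((Module.AEval'.of N).symm (F q))
  rw [map_smul]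
  exact Module.AEval.of_symm_X_smul _ _

namespace MvPolynomial

theorem finrank_homogeneousSubmodule_fin_two_le (k : Type*) [Field k] (m : ℕ) :
    Module.finrank k (homogeneousSubmodule (Fin 2) k m) ≤ m + 1 := by
  classical
  let s : Finset (MvPolynomial (Fin 2) k) :=
    (Finset.range (m + 1)).image fun i ↦ monomial (Finsupp.single 0 i + Finsupp.single 1 (m - i)) 1
  have hle : homogeneousSubmodule (Fin 2) k m ≤ Submodule.span k (s : Set _) := by
    intro f hf
    rw [f.as_sum]
    refine Submodule.sum_mem _ fun d hd ↦ ?_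
    have hdm : d 0 + d 1 = m := by
      rw [← Fin.sum_univ_two, ← Finsupp.degree_eq_sum]
      exact (hf.degree_eq_sum_deg_support hd).symm
    have : monomial d (f.coeff d) = f.coeff d • monomial d (1 : k) := by
      rw [smul_monomial, smul_eq_mul, mul_one]
    rw [this]
    refine Submodule.smul_mem _ _ (Submodule.subset_span ?_)
    refine Finset.mem_coe.2 (Finset.mem_image.2 ⟨d 0, Finset.mem_range.2 (by omega), ?_⟩)
    suffices Finsupp.single 0 (d 0) + Finsupp.single 1 (m - d 0) = d by rw [this]
    ext i
    fin_cases i <;> simp [← hdm]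
  calc _ ≤ Module.finrank k (Submodule.span k (s : Set (MvPolynomial (Fin 2) k))) :=
        Submodule.finrank_mono hle
    _ ≤ s.card := finrank_span_finset_le_card s
    _ ≤ m + 1 := Finset.card_image_le.trans (Finset.card_range _).le

/-- The action of square matrices on polynomials by linear substitutions, the `i`-th variable being
sent to the linear form whose coefficients are the `i`-th column. -/
noncomputable def linearSubst {σ k : Type*} [Fintype σ] [DecidableEq σ] [CommRing k] :
    Matrix σ σ k →* (MvPolynomial σ k →ₐ[k] MvPolynomial σ k) where
  toFun g := aeval fun i ↦ ∑ j, C (g j i) * X j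
  map_one' := by
    ext i : 1
    simp [Matrix.one_apply]
  map_mul' g h := by
    ext i : 1
    simp only [aeval_X, AlgHom.mul_apply, map_sum, map_mul, Matrix.mul_apply, Finset.sum_mul,
      Finset.mul_sum, algHom_C, algebraMap_eq]
    rw [Finset.sum_comm]
    exact Finset.sum_congr rfl fun _ _ ↦ Finset.sum_congr rfl fun _ _ ↦ by ring

theorem linearSubst_X {σ k : Type*} [Fintype σ] [DecidableEq σ] [CommRing k]
    (g : Matrix σ σ k) (i : σ) : linearSubst g (X i) = ∑ j, C (g j i) * X j :=
  aeval_X _ _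

theorem IsHomogeneous.linearSubst {σ k : Type*} [Fintype σ] [DecidableEq σ] [CommRing k]
    {f : MvPolynomial σ k} {m : ℕ} (hf : f.IsHomogeneous m) (g : Matrix σ σ k) :
    (linearSubst g f).IsHomogeneous m := by
  have := hf.aeval (fun i ↦ ∑ j, C (g j i) * X j) (n := 1) fun i ↦
    IsHomogeneous.sum _ _ _ fun j _ ↦ isHomogeneous_C_mul_X _ _
  rwa [one_mul] at this

/-- The action of matrices by linear substitutions on homogeneous polynomials of degree `m`. -/
noncomputable def homogeneousRep (σ k : Type*) [Fintype σ] [DecidableEq σ] [CommRing k] (m : ℕ) :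
    Representation k (Matrix σ σ k) (homogeneousSubmodule σ k m) where
  toFun g := (linearSubst g).toLinearMap.restrict fun _ hf ↦ IsHomogeneous.linearSubst hf g
  map_one' := by ext; simp
  map_mul' g h := by
    ext : 2
    exact DFunLike.congr_fun (map_mul linearSubst g h) _

theorem eval_linearSubst {σ k : Type*} [Fintype σ] [DecidableEq σ] [CommRing k]
    (g : Matrix σ σ k) (x : σ → k) (f : MvPolynomial σ k) :
    eval x (linearSubst g f) = eval (fun i ↦ ∑ j, g j i * x j) f := by
  induction f using MvPolynomial.induction_on with
  | C a => simp
  | add f g hf hg => simp [hf, hg]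
  | mul_X f i hf => simp [hf, linearSubst_X]

theorem eval_linearSubst_transvection {k : Type*} [CommRing k] (f : MvPolynomial (Fin 2) k)
    (t : k) : eval ![1, t] (linearSubst !![1, 1; 0, 1] f) = eval ![1, t + 1] f := by
  rw [eval_linearSubst]
  congr 2
  ext i
  fin_cases i <;> simp [add_comm]

theorem eval_homogeneousRep_sub_one_pow {k : Type*} [CommRing k] (m j : ℕ)
    (f : homogeneousSubmodule (Fin 2) k m) :
    (fun t ↦ eval ![1, t]
      (((homogeneousRep (Fin 2) k m !![1, 1; 0, 1] - 1) ^ j) f : MvPolynomial (Fin 2) k)) =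
      (fwdDiff 1)^[j] fun t ↦ eval ![1, t] (f : MvPolynomial (Fin 2) k) := by
  induction j with
  | zero => simp
  | succ j ih =>
    rw [Function.iterate_succ_apply', ← ih, pow_succ']
    ext t
    simp only [fwdDiff, ← eval_linearSubst_transvection]
    rw [Module.End.mul_apply, LinearMap.sub_apply, Submodule.coe_sub, map_sub]
    rfl

end MvPolynomial

open Polynomial in
/-- In characteristic `p`, a Jordan block of size at most `p` is the image of the standard
transvection under a representation of `SL₂`. -/
theorem exists_representation_quotient_X_pow (k : Type*) [Field k] (p : ℕ) [Fact p.Prime]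
    [CharP k p] (d : ℕ) (hd : d ≤ p) (g : Matrix.SpecialLinearGroup (Fin 2) k)
    (hg : (g : Matrix (Fin 2) (Fin 2) k) = !![1, 1; 0, 1]) :
    ∃ ρ : Representation k (Matrix.SpecialLinearGroup (Fin 2) k)
        (k[X] ⧸ Ideal.span {(X : k[X]) ^ d}), ∀ q, ρ g q = q + (X : k[X]) • q := by
  obtain _ | m := d
  · have : Subsingleton (k[X] ⧸ Ideal.span {(X : k[X]) ^ 0}) :=
      Ideal.Quotient.subsingleton_iff.2 (by simp)
    exact ⟨1, fun q ↦ Subsingleton.elim _ _⟩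
  let ρ : Representation k (Matrix.SpecialLinearGroup (Fin 2) k)
      (MvPolynomial.homogeneousSubmodule (Fin 2) k m) :=
    (MvPolynomial.homogeneousRep (Fin 2) k m).comp
      ((Units.coeHom _).comp Matrix.SpecialLinearGroup.toGL)
  have hρg : ρ g = MvPolynomial.homogeneousRep (Fin 2) k m !![1, 1; 0, 1] := by rw [← hg]; rfl
  have hgp : g ^ p = 1 := by
    refine Subtype.ext (sub_eq_zero.1 ?_)
    have hsq : ((g : Matrix (Fin 2) (Fin 2) k) - 1) ^ 2 = 0 := by
      rw [hg, pow_two, Matrix.one_fin_two]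
      ext i j
      fin_cases i <;> fin_cases j <;> simp
    rw [Matrix.SpecialLinearGroup.coe_pow, Matrix.SpecialLinearGroup.coe_one,
      ← sub_one_pow_char_eq k]
    exact pow_eq_zero_of_le (Fact.out : p.Prime).two_le hsq
  have hnil : IsNilpotent (ρ g - 1) := by
    refine ⟨p, ?_⟩
    refine (sub_one_pow_char_eq k p (A := Module.End k _) (ρ g)).trans ?_
    rw [← map_pow, hgp, map_one, sub_self]
  have : Module.Finite k (MvPolynomial.homogeneousSubmodule (Fin 2) k m) :=
    Module.Finite.iff_fg.2 (MvPolynomial.homogeneousSubmodule_fg _ _ m)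
  let w : MvPolynomial.homogeneousSubmodule (Fin 2) k m :=
    ⟨MvPolynomial.X 1 ^ m, MvPolynomial.isHomogeneous_X_pow 1 m⟩
  have hw : ((ρ g - 1) ^ m) w ≠ 0 := by
    intro h
    have := congrFun (MvPolynomial.eval_homogeneousRep_sub_one_pow m m w) 0
    rw [← hρg, h] at this
    simp [w, fwdDiff_iter_eq_factorial] at this
    rw [eq_comm, CharP.cast_eq_zero_iff k p, (Fact.out : p.Prime).dvd_factorial] at this
    omega
  obtain ⟨e, he⟩ := Module.End.exists_quotient_X_pow_linearEquiv (ρ g - 1) hnil m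
    (MvPolynomial.finrank_homogeneousSubmodule_fin_two_le k m) w hw
  refine ⟨(e.symm.conjAlgEquiv k : _ →* _).comp ρ, fun q ↦ ?_⟩
  apply e.injective
  rw [map_add, he]
  simp

open Polynomial in
/-- **Theorem 1 (Testerman) for `G = GL_n`.**  Let `k` be an algebraically closed field of
characteristic `p > 0`, let `n ≥ 1`, and let `u ∈ GL(n,k)` be a unipotent matrix
(i.e. `u - 1` is nilpotent) satisfying `u ^ p = 1`.  Then there is a group homomorphism
`φ : SL(2,k) → GL(n,k)` whose image contains `u`. -/
theorem testerman_GLn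
    (p : ℕ) (hp : 0 < p) (k : Type*) [Field k] [IsAlgClosed k] [CharP k p]
    (n : ℕ) (hn : 1 ≤ n)
    (u : Matrix.GeneralLinearGroup (Fin n) k)
    (hu : IsNilpotent ((u : Matrix (Fin n) (Fin n) k) - 1))
    (hup : u ^ p = 1) :
    ∃ φ : Matrix.SpecialLinearGroup (Fin 2) k →* Matrix.GeneralLinearGroup (Fin n) k,
      u ∈ Set.range φ := by
  have : Fact p.Prime := ⟨(CharP.char_is_prime_or_zero k p).resolve_right hp.ne'⟩
  let N : Module.End k (Fin n → k) := Matrix.toLinAlgEquiv' ((u : Matrix (Fin n) (Fin n) k) - 1)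
  have hN : N ^ p = 0 := by
    rw [← map_pow, sub_one_pow_char_eq k, ← Units.val_pow_eq_pow_val, hup, Units.val_one, sub_self,
      map_zero]
  have hXp (x : Module.AEval' N) : (X : k[X]) ^ p • x = 0 := by
    obtain ⟨x, rfl⟩ := (Module.AEval'.of N).surjective x
    rw [Module.AEval'.X_pow_smul_of, hN]
    simp
  obtain ⟨r, d, ⟨e⟩⟩ := Module.torsion_by_prime_power_decomposition (p := (X : k[X]))
    prime_X.irreducible (M := Module.AEval' N) fun {x} ↦ ⟨⟨X ^ p, p, rfl⟩, hXp x⟩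
  have hd (i : Fin r) : d i ≤ p := by
    let q : k[X] ⧸ Ideal.span {(X : k[X]) ^ d i} := 1
    have h : (X : k[X]) ^ p •
        DirectSum.lof k[X] _ (fun i ↦ k[X] ⧸ Ideal.span {(X : k[X]) ^ d i}) i q = 0 := by
      apply e.symm.injective
      rw [map_smul, map_zero]
      exact hXp _
    rw [← map_smul] at h
    have hq : (X : k[X]) ^ p • q = 0 := by
      have := DFunLike.congr_fun h i
      rwa [DirectSum.lof_apply] at this
    have hmem : (X : k[X]) ^ p ∈ Ideal.span {(X : k[X]) ^ d i} :=
      Ideal.Quotient.eq_zero_iff_mem.1 ((Algebra.algebraMap_eq_smul_one _).trans hq)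
    exact (pow_dvd_pow_iff X_ne_zero not_isUnit_X).1 (Ideal.mem_span_singleton.1 hmem)
  let g : Matrix.SpecialLinearGroup (Fin 2) k := ⟨!![1, 1; 0, 1], by simp⟩
  choose ρ hρ using fun i ↦ exists_representation_quotient_X_pow k p (d i) (hd i) g rfl
  let E : (Fin n → k) ≃ₗ[k] DirectSum (Fin r) fun i ↦ k[X] ⧸ Ideal.span {(X : k[X]) ^ d i} :=
    (Module.AEval'.of N).trans (e.restrictScalars k)
  have hE (x) : E (N x) = (X : k[X]) • E x :=
    (congrArg e (Module.AEval'.X_smul_of N x).symm).trans (map_smul e _ _)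
  let ψ : Matrix.SpecialLinearGroup (Fin 2) k →* Matrix (Fin n) (Fin n) k :=
    (LinearMap.toMatrixAlgEquiv' : _ ≃ₐ[k] Matrix (Fin n) (Fin n) k).toMonoidHom.comp
      ((E.symm.conjAlgEquiv k : _ →* _).comp (Representation.directSum ρ))
  refine ⟨ψ.toHomUnits, g, Units.ext ?_⟩
  have hsum (y) : Representation.directSum ρ g y = y + (X : k[X]) • y := by
    ext i : 1
    exact hρ i (y i)
  have hψ : (E.symm.conjAlgEquiv k) (Representation.directSum ρ g) = 1 + N := by
    refine LinearMap.ext fun x ↦ ?_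
    change E.symm (Representation.directSum ρ g (E x)) = x + N x
    rw [hsum, ← hE, ← map_add, E.symm_apply_apply]
  change LinearMap.toMatrixAlgEquiv' ((E.symm.conjAlgEquiv k) (Representation.directSum ρ g)) = _
  rw [hψ, map_add, map_one, LinearMap.toMatrixAlgEquiv'_toLinAlgEquiv', add_sub_cancel]
end

section
/- Let k be an algebraically closed field of characteristic p > 0 and let u ∈ GL(n, k) be a unipotent matrix with u^p = 1; let d_1, …, d_r be the sizes of the Jordan blocks of u (so each d_i ≤ p and d_1 + ⋯ + d_r = n). Then there exist a group homomorphism φ : SL(2, k) → GL(n, k) and g ∈ GL(n, k) such that: (i) g · φ([[1,1],[0,1]]) · g⁻¹ = u, and (ii) for every t ∈ kˣ, φ([[t,0],[0,t⁻¹]]) is the diagonal matrix whose multiset of diagonal entries is the union over i = 1,…,r of {t^{d_i−1}, t^{d_i−3}, …, t^{1−d_i}}. -/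
/-- The `m × m` Jordan block with eigenvalue `1`. -/
def jordanBlockOne (k : Type*) [Zero k] [One k] (m : ℕ) : Matrix (Fin m) (Fin m) k :=
  Matrix.of fun i j => if i = j then 1 else if (i : ℕ) + 1 = (j : ℕ) then 1 else 0

/-- The vector of degree `m - 1` monomials `x ^ (m - 1 - j) * y ^ j` in `x` and `y`. -/
def binaryMonomials {k : Type*} [CommSemiring k] (m : ℕ) (x y : k) : Fin m → k :=
  fun j => x ^ (j.rev : ℕ) * y ^ (j : ℕ)

open Polynomial in
/-- The matrix by which `A` acts on binary monomials of degree `m - 1`. -/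
noncomputable def binaryFormMatrix {k : Type*} [CommRing k] (m : ℕ)
    (A : Matrix (Fin 2) (Fin 2) k) : Matrix (Fin m) (Fin m) k :=
  Matrix.of fun i j =>
    ((C (A 0 0) * X + C (A 0 1)) ^ (i.rev : ℕ) *
      (C (A 1 0) * X + C (A 1 1)) ^ (i : ℕ)).coeff (j.rev : ℕ)

section

open Polynomial Matrix

theorem Polynomial.sum_coeff_rev_mul_pow {k : Type*} [CommRing k] {m : ℕ} {f : k[X]}
    (hf : f.natDegree < m) (x : k) :
    ∑ j : Fin m, f.coeff (j.rev : ℕ) * x ^ (j.rev : ℕ) = f.eval x := by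
  rw [eval_eq_sum_range' hf, ← Fin.sum_univ_eq_sum_range (fun i => f.coeff i * x ^ i)]
  exact Equiv.sum_comp Fin.revPerm (fun j : Fin m => f.coeff (j : ℕ) * x ^ (j : ℕ))

theorem binaryMonomials_eq_smul {k : Type*} [Field k] (m : ℕ) (x : k) {y : k} (hy : y ≠ 0) :
    binaryMonomials m x y = y ^ (m - 1) • binaryMonomials m (x / y) 1 := by
  ext j
  have h : m - 1 = (j.rev : ℕ) + (j : ℕ) := by rw [Fin.val_rev]; omega
  simp only [binaryMonomials, Pi.smul_apply, smul_eq_mul, h, div_pow, one_pow, mul_one, pow_add]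
  field_simp

theorem binaryFormMatrix_mulVec {k : Type*} [Field k] (m : ℕ) (A : Matrix (Fin 2) (Fin 2) k)
    (x : k) {y : k} (hy : y ≠ 0) :
    binaryFormMatrix m A *ᵥ binaryMonomials m x y =
      binaryMonomials m (A 0 0 * x + A 0 1 * y) (A 1 0 * x + A 1 1 * y) := by
  rw [binaryMonomials_eq_smul m x hy, mulVec_smul]
  ext i
  have h : m - 1 = (i.rev : ℕ) + (i : ℕ) := by rw [Fin.val_rev]; omega
  have hdeg : ((C (A 0 0) * X + C (A 0 1)) ^ (i.rev : ℕ) *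
      (C (A 1 0) * X + C (A 1 1)) ^ (i : ℕ)).natDegree < m := by
    have h1 := natDegree_pow_le_of_le (i.rev : ℕ) (natDegree_linear_le (a := A 0 0) (b := A 0 1))
    have h2 := natDegree_pow_le_of_le (i : ℕ) (natDegree_linear_le (a := A 1 0) (b := A 1 1))
    have h3 := natDegree_mul_le_of_le h1 h2
    have := i.isLt
    omega
  have key := sum_coeff_rev_mul_pow hdeg (x / y)
  simp only [Pi.smul_apply, smul_eq_mul, mulVec, dotProduct, binaryFormMatrix, of_apply,
    binaryMonomials, one_pow, mul_one, key]
  have e1 : ∀ a b : k, a * x + b * y = y * (a * (x / y) + b) := by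
    intro a b; field_simp
  simp only [e1, mul_pow, h, pow_add, eval_mul, eval_pow, eval_add, eval_C, eval_X]
  ring

theorem Matrix.eq_of_mulVec_binaryMonomials {k : Type*} [Field k] {ι : Type*} {m : ℕ}
    {M M' : Matrix ι (Fin m) k} {s : Set k} (hs : s.Infinite)
    (h : ∀ x ∈ s, M *ᵥ binaryMonomials m x 1 = M' *ᵥ binaryMonomials m x 1) : M = M' := by
  ext i j
  let f : k[X] := ∑ j : Fin m, C (M i j - M' i j) * X ^ (j.rev : ℕ)
  have hf : f = 0 := by
    refine eq_zero_of_infinite_isRoot f (hs.mono fun x hx => ?_)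
    have := congrFun (h x hx) i
    simp only [mulVec, dotProduct, binaryMonomials, one_pow, mul_one] at this
    simp [f, IsRoot, eval_finsetSum, sub_mul, Finset.sum_sub_distrib, -Fin.val_rev, this]
  have hc := congrArg (fun q : k[X] => q.coeff (j.rev : ℕ)) hf
  simp only [f, finsetSum_coeff, coeff_C_mul_X_pow, coeff_zero, Fin.val_inj, Fin.rev_inj,
    Finset.sum_ite_eq, Finset.mem_univ, if_true] at hc
  exact sub_eq_zero.mp hc

theorem binaryFormMatrix_mul {k : Type*} [Field k] [Infinite k] (m : ℕ)
    (A B : Matrix.SpecialLinearGroup (Fin 2) k) :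
    binaryFormMatrix m (A * B : Matrix (Fin 2) (Fin 2) k) =
      binaryFormMatrix m (A : Matrix (Fin 2) (Fin 2) k) *
        binaryFormMatrix m (B : Matrix (Fin 2) (Fin 2) k) := by
  have hfin : {x : k | B 1 0 * x + B 1 1 = 0}.Finite := by
    have hdet := B.det_coe
    rw [det_fin_two] at hdet
    refine Set.Subsingleton.finite fun x hx y hy => ?_
    simp only [Set.mem_ofPred_eq] at hx hy
    have hc : B 1 0 ≠ 0 := by
      intro hc
      simp_all
    exact mul_left_cancel₀ hc (by linear_combination hx - hy)
  refine eq_of_mulVec_binaryMonomials hfin.infinite_compl fun x hx => ?_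
  have hy : B 1 0 * x + B 1 1 * 1 ≠ 0 := by simpa using hx
  rw [← mulVec_mulVec, binaryFormMatrix_mulVec m _ x one_ne_zero,
    binaryFormMatrix_mulVec m _ x one_ne_zero, binaryFormMatrix_mulVec m _ _ hy]
  simp only [mul_apply, Fin.sum_univ_two]
  congr 1 <;> ring

theorem binaryFormMatrix_diagonal {k : Type*} [Field k] [Infinite k] (m : ℕ) (a b : k) :
    binaryFormMatrix m !![a, 0; 0, b] =
      diagonal fun j : Fin m => a ^ (j.rev : ℕ) * b ^ (j : ℕ) := by
  refine eq_of_mulVec_binaryMonomials Set.infinite_univ fun x _ => ?_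
  rw [binaryFormMatrix_mulVec m _ x one_ne_zero]
  ext j
  simp [mulVec_diagonal, binaryMonomials, mul_pow]
  ring

/-- The representation of `SL(2, k)` on binary forms of degree `m - 1`, in the monomial basis. -/
noncomputable def binaryFormRep (k : Type*) [Field k] [Infinite k] (m : ℕ) :
    Matrix.SpecialLinearGroup (Fin 2) k →* Matrix (Fin m) (Fin m) k where
  toFun A := binaryFormMatrix m (A : Matrix (Fin 2) (Fin 2) k)
  map_one' := by
    have := binaryFormMatrix_diagonal (k := k) m 1 1
    simpa [← one_fin_two] using this
  map_mul' A B := binaryFormMatrix_mul m A B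

/-- The matrix of coefficients of the binomial polynomials `X.choose (m - 1 - i)`. -/
noncomputable def binomialCoeffMatrix (k : Type*) [Field k] (m : ℕ) : Matrix (Fin m) (Fin m) k :=
  Matrix.of fun i j =>
    (((i.rev : ℕ).factorial : k)⁻¹) * (descPochhammer k (i.rev : ℕ)).coeff (j.rev : ℕ)

theorem isUnit_binomialCoeffMatrix {k : Type*} [Field k] {m : ℕ}
    (hm : ∀ i < m, (i.factorial : k) ≠ 0) : IsUnit (binomialCoeffMatrix k m) := by
  rw [isUnit_iff_isUnit_det, isUnit_iff_ne_zero]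
  have hP : (of fun i j : Fin m => (descPochhammer k (i.rev : ℕ)).coeff (j.rev : ℕ)).det = 1 := by
    rw [← det_matrixOfPolynomials (fun i : Fin m => descPochhammer k (i : ℕ))
      (fun i => descPochhammer_natDegree k i) (fun i => monic_descPochhammer k i),
      ← det_transpose, ← det_submatrix_equiv_self Fin.revPerm]
    congr 1
    ext i j
    simp [-Fin.val_rev]
  have hQ : binomialCoeffMatrix k m = of fun i j : Fin m => (((i.rev : ℕ).factorial : k)⁻¹) *
      (of fun i j : Fin m => (descPochhammer k (i.rev : ℕ)).coeff (j.rev : ℕ)) i j := rfl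
  rw [hQ, det_mul_column, hP, mul_one]
  exact Finset.prod_ne_zero_iff.mpr fun i _ => inv_ne_zero (hm _ i.rev.isLt)

theorem binomialCoeffMatrix_mulVec {k : Type*} [Field k] (m : ℕ) (x : k) (i : Fin m) :
    (binomialCoeffMatrix k m *ᵥ binaryMonomials m x 1) i =
      ((i.rev : ℕ).factorial : k)⁻¹ * (descPochhammer k (i.rev : ℕ)).eval x := by
  have hdeg : (descPochhammer k (i.rev : ℕ)).natDegree < m := by
    rw [descPochhammer_natDegree]; exact i.rev.isLt
  rw [← sum_coeff_rev_mul_pow hdeg, Finset.mul_sum]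
  simp [mulVec, dotProduct, binomialCoeffMatrix, binaryMonomials, mul_assoc]

theorem eval_add_one_descPochhammer_succ {k : Type*} [CommRing k] (n : ℕ) (x : k) :
    (descPochhammer k (n + 1)).eval (x + 1) =
      (descPochhammer k (n + 1)).eval x + (n + 1) * (descPochhammer k n).eval x := by
  have h := congrArg (eval (x + 1)) (descPochhammer_succ_comp_X_sub_one (R := k) n)
  simp [eval_comp] at h
  linear_combination -h

theorem jordanBlockOne_mulVec {k : Type*} [Semiring k] {m : ℕ} (v : Fin m → k) (i : Fin m) :
    (jordanBlockOne k m *ᵥ v) i =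
      v i + if h : (i : ℕ) + 1 < m then v ⟨i + 1, h⟩ else 0 := by
  have hsplit : ∀ j : Fin m, jordanBlockOne k m i j * v j =
      (if i = j then v j else 0) + if (i : ℕ) + 1 = j then v j else 0 := by
    intro j
    by_cases h : i = j
    · subst h; simp [jordanBlockOne]
    · simp [jordanBlockOne, h]
  simp only [mulVec, dotProduct, hsplit, Finset.sum_add_distrib, Finset.sum_ite_eq,
    Finset.mem_univ, if_true]
  congr 1
  split_ifs with h
  · rw [Finset.sum_eq_single ⟨i + 1, h⟩ _ (by simp)]
    · simp
    · intro j _ hj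
      exact if_neg fun h' => hj (Fin.ext h'.symm)
  · exact Finset.sum_eq_zero fun j _ => if_neg (by have := j.isLt; omega)

theorem binomialCoeffMatrix_mul_binaryFormMatrix {k : Type*} [Field k] [Infinite k] {m : ℕ}
    (hm : ∀ i < m, (i.factorial : k) ≠ 0) :
    binomialCoeffMatrix k m * binaryFormMatrix m !![1, 1; 0, 1] =
      jordanBlockOne k m * binomialCoeffMatrix k m := by
  refine eq_of_mulVec_binaryMonomials Set.infinite_univ fun x _ => ?_
  rw [← mulVec_mulVec, ← mulVec_mulVec, binaryFormMatrix_mulVec m _ x one_ne_zero]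
  ext i
  have hx : binaryMonomials m
      ((!![1, 1; 0, 1] : Matrix (Fin 2) (Fin 2) k) 0 0 * x + !![1, 1; 0, 1] 0 1 * 1)
      (!![1, 1; 0, 1] 1 0 * x + !![1, 1; 0, 1] 1 1 * 1) = binaryMonomials m (x + 1) 1 := by
    simp
  rw [hx, jordanBlockOne_mulVec, binomialCoeffMatrix_mulVec, binomialCoeffMatrix_mulVec]
  split_ifs with h
  · rw [binomialCoeffMatrix_mulVec]
    obtain ⟨n, hn⟩ : ∃ n, n = m - (i + 1 + 1) := ⟨_, rfl⟩
    have h1 : (i.rev : ℕ) = n + 1 := by rw [Fin.val_rev]; omega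
    have h2 : ((⟨i + 1, h⟩ : Fin m).rev : ℕ) = n := by rw [Fin.val_rev, hn]
    have hfac := hm (n + 1) (by omega)
    rw [h1, h2, eval_add_one_descPochhammer_succ]
    rw [Nat.factorial_succ] at hfac ⊢
    push_cast at hfac ⊢
    have ha := left_ne_zero_of_mul hfac
    have hb := right_ne_zero_of_mul hfac
    field_simp
  · have h1 : (i.rev : ℕ) = 0 := by rw [Fin.val_rev]; omega
    simp [h1, -Fin.val_rev]

/-- The direct sum of the representations of `SL(2, k)` on binary forms of degrees `d i - 1`. -/
noncomputable def sumBinaryFormRep (k : Type*) [Field k] [Infinite k] {r n : ℕ} {d : Fin r → ℕ}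
    (e : ((i : Fin r) × Fin (d i)) ≃ Fin n) :
    Matrix.SpecialLinearGroup (Fin 2) k →* Matrix.GeneralLinearGroup (Fin n) k :=
  MonoidHom.toHomUnits <|
    ((reindexRingEquiv k e).toRingHom.comp
      (blockDiagonal'RingHom (fun i => Fin (d i)) k)).toMonoidHom.comp
        (MonoidHom.pi fun i => binaryFormRep k (d i))

theorem coe_sumBinaryFormRep (k : Type*) [Field k] [Infinite k] {r n : ℕ} {d : Fin r → ℕ}
    (e : ((i : Fin r) × Fin (d i)) ≃ Fin n) (A : Matrix.SpecialLinearGroup (Fin 2) k) :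
    (sumBinaryFormRep k e A : Matrix (Fin n) (Fin n) k) =
      reindex e e (blockDiagonal' fun i => binaryFormMatrix (d i) (A : Matrix _ _ k)) :=
  rfl

theorem CharP.cast_factorial_ne_zero {k : Type*} [Field k] {p : ℕ} [CharP k p] (hp : 0 < p)
    {i : ℕ} (hi : i < p) : (i.factorial : k) ≠ 0 := by
  have hprime : p.Prime := (CharP.char_is_prime_or_zero k p).resolve_right hp.ne'
  rw [Ne, CharP.cast_eq_zero_iff k p, hprime.dvd_factorial]
  omega

end

/-- **Theorem 2 (Lawther–Testerman) for `G = GL_n`.**  Let `k` be algebraically closed of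
characteristic `p > 0` and let `u ∈ GL(n,k)` be unipotent with `u ^ p = 1`, with Jordan block
sizes `d 1, …, d r` (each `d i ≤ p`, `∑ d i = n`).  Then there are a homomorphism
`φ : SL(2,k) → GL(n,k)` and `g ∈ GL(n,k)` with (i) `g * φ [[1,1],[0,1]] * g⁻¹ = u`, and
(ii) for every `t ∈ kˣ`, `φ (diag (t, t⁻¹))` is a diagonal matrix whose multiset of diagonal
entries is the union over `i` of `{t^(d i - 1), t^(d i - 3), …, t^(1 - d i)}`. -/
theorem lawther_testerman_GLn
    (p : ℕ) (hp : 0 < p) (k : Type*) [Field k] [IsAlgClosed k] [CharP k p]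
    (n : ℕ) (u : Matrix.GeneralLinearGroup (Fin n) k)
    (hu : IsNilpotent ((u : Matrix (Fin n) (Fin n) k) - 1))
    (hup : u ^ p = 1)
    (r : ℕ) (d : Fin r → ℕ)
    (hdpos : ∀ i, 0 < d i) (hdp : ∀ i, d i ≤ p) (hdsum : ∑ i, d i = n)
    (e : ((i : Fin r) × Fin (d i)) ≃ Fin n)
    (g₀ : Matrix.GeneralLinearGroup (Fin n) k)
    (hjordan : (u : Matrix (Fin n) (Fin n) k) =
      (g₀ : Matrix (Fin n) (Fin n) k) *
        (Matrix.reindex e e (Matrix.blockDiagonal' fun i : Fin r => jordanBlockOne k (d i))) *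
        ((g₀⁻¹ : Matrix.GeneralLinearGroup (Fin n) k) : Matrix (Fin n) (Fin n) k)) :
    ∃ (φ : Matrix.SpecialLinearGroup (Fin 2) k →* Matrix.GeneralLinearGroup (Fin n) k)
      (g : Matrix.GeneralLinearGroup (Fin n) k),
      g * φ ⟨!![1, 1; 0, 1], by simp [Matrix.det_fin_two_of]⟩ * g⁻¹ = u ∧
      ∀ t : kˣ, ∃ dv : Fin n → k,
        ((φ ⟨!![(t : k), 0; 0, ((t⁻¹ : kˣ) : k)], by simp [Matrix.det_fin_two_of]⟩ :
            Matrix.GeneralLinearGroup (Fin n) k) : Matrix (Fin n) (Fin n) k) =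
          Matrix.diagonal dv ∧
        Multiset.map dv (Finset.univ.val : Multiset (Fin n)) =
          (Finset.univ.val : Multiset (Fin r)).bind fun i =>
            (Multiset.range (d i)).map fun j : ℕ =>
              ((t ^ ((d i : ℤ) - 1 - 2 * (j : ℤ)) : kˣ) : k) := by
  have hm : ∀ i, ∀ j < d i, (j.factorial : k) ≠ 0 := fun i j hj =>
    CharP.cast_factorial_ne_zero hp (hj.trans_le (hdp i))
  let F := (Matrix.reindexRingEquiv k e).toRingHom.comp
    (Matrix.blockDiagonal'RingHom (fun i => Fin (d i)) k)
  have hQ : IsUnit (F fun i => binomialCoeffMatrix k (d i)) :=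
    (Pi.isUnit_iff.mpr fun i => isUnit_binomialCoeffMatrix (hm i)).map F
  obtain ⟨Q, hQ⟩ := hQ
  refine ⟨sumBinaryFormRep k e, g₀ * Q, ?_, fun t => ⟨fun x =>
    (t : k) ^ ((e.symm x).2.rev : ℕ) * ((t⁻¹ : kˣ) : k) ^ ((e.symm x).2 : ℕ), ?_, ?_⟩⟩
  · rw [mul_inv_rev, ← mul_assoc, mul_inv_eq_iff_eq_mul, mul_inv_eq_iff_eq_mul]
    have hconj : (Q : Matrix (Fin n) (Fin n) k) *
        (sumBinaryFormRep k e ⟨!![1, 1; 0, 1], by simp [Matrix.det_fin_two_of]⟩ :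
          Matrix.GeneralLinearGroup (Fin n) k) =
        Matrix.reindex e e (Matrix.blockDiagonal' fun i : Fin r => jordanBlockOne k (d i)) * Q := by
      rw [hQ]
      change F (fun i => binomialCoeffMatrix k (d i)) *
          F (fun i => binaryFormMatrix (d i) !![1, 1; 0, 1]) =
        F (fun i => jordanBlockOne k (d i)) * F (fun i => binomialCoeffMatrix k (d i))
      rw [← map_mul, ← map_mul]
      exact congrArg F (funext fun i => binomialCoeffMatrix_mul_binaryFormMatrix (hm i))
    ext1
    rw [Units.val_mul, Units.val_mul, Units.val_mul, Units.val_mul, mul_assoc, hconj, hjordan,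
      mul_assoc _ _ (g₀ : Matrix (Fin n) (Fin n) k), Units.inv_mul, mul_one, mul_assoc]
  · refine (coe_sumBinaryFormRep k e _).trans ?_
    simp only [binaryFormMatrix_diagonal, Matrix.blockDiagonal'_diagonal, Matrix.reindex_apply,
      Matrix.submatrix_diagonal_equiv]
    rfl
  · let G : ((i : Fin r) × Fin (d i)) → k := fun a =>
      (t : k) ^ (a.2.rev : ℕ) * ((t⁻¹ : kˣ) : k) ^ (a.2 : ℕ)
    have hreindex : Multiset.map (fun x => G (e.symm x)) (Finset.univ : Finset (Fin n)).val =
        Multiset.map G (Finset.univ : Finset ((i : Fin r) × Fin (d i))).val := by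
      rw [← Finset.map_univ_equiv e.symm, Finset.map_val, Multiset.map_map]
      rfl
    refine hreindex.trans ?_
    have hsigma : (Finset.univ : Finset ((i : Fin r) × Fin (d i))).val =
        (Finset.univ : Finset (Fin r)).val.bind fun i =>
          (Finset.univ : Finset (Fin (d i))).val.map (Sigma.mk i) := by
      rw [← Finset.univ_sigma_univ]
      rfl
    rw [hsigma, Multiset.map_bind]
    refine Multiset.bind_congr fun i _ => ?_
    have hrange : Multiset.range (d i) =
        Multiset.map (fun j : Fin (d i) => (j : ℕ)) Finset.univ.val := by
      rw [← Finset.range_val, ← Nat.Iio_eq_range, ← Fin.map_valEmbedding_univ, Finset.map_val]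
      rfl
    rw [hrange, Multiset.map_map, Multiset.map_map]
    refine Multiset.map_congr rfl fun j _ => ?_
    have hexp : (d i : ℤ) - 1 - 2 * ((j : ℕ) : ℤ) = ((j.rev : ℕ) : ℤ) - ((j : ℕ) : ℤ) := by
      rw [Fin.val_rev]
      omega
    simp only [Function.comp_apply, G, hexp]
    rw [zpow_sub, zpow_natCast, zpow_natCast, ← inv_pow]
    simp only [Units.val_mul, Units.val_pow_eq_pow_val]
end

section
/- Let Λ be an integral domain in which 2 ≠ 0, and let L be a Lie algebra over Λ whose underlying Λ-module is torsion-free. Suppose X, Y, H ∈ L satisfy [X,Y] = H, [H,X] = 2X and [H,Y] = −2Y, and that (X, Y, H) ≠ (0, 0, 0). Then X, Y and H are Λ-linearly independent; equivalently, the Λ-linear map from sl₂(Λ) to L sending the matrix [[a, b],[c, −a]] to bX + cY + aH is an injective Lie algebra homomorphism. -/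
/-- An `sl₂`-triple `(X, Y, H) ≠ (0,0,0)` over an integral domain `Λ` with `2 ≠ 0`, inside a
Lie algebra `L` whose underlying `Λ`-module is torsion-free, consists of `Λ`-linearly
independent elements; equivalently, the induced linear map `sl₂(Λ) → L` is an injective Lie
algebra homomorphism. -/
theorem sl2_triple_linearIndependent
    (Λ : Type*) [CommRing Λ] [IsDomain Λ] (h2 : (2 : Λ) ≠ 0)
    (L : Type*) [LieRing L] [LieAlgebra Λ L]
    (htf : ∀ (a : Λ) (m : L), a • m = 0 → a = 0 ∨ m = 0)
    (X Y H : L)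
    (hXY : ⁅X, Y⁆ = H)
    (hHX : ⁅H, X⁆ = (2 : Λ) • X)
    (hHY : ⁅H, Y⁆ = -((2 : Λ) • Y))
    (hne : ¬(X = 0 ∧ Y = 0 ∧ H = 0)) :
    LinearIndependent Λ ![X, Y, H] := by
  have cancel_two {m : L} (hm : (2 : Λ) • m = 0) : m = 0 := (htf 2 m hm).resolve_left h2
  have hH : H ≠ 0 := by
    rintro rfl
    rw [zero_lie] at hHX hHY
    exact hne ⟨cancel_two hHX.symm, cancel_two (neg_eq_zero.mp hHY.symm), rfl⟩
  have hX : X ≠ 0 := by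
    rintro rfl
    exact hH (by rw [← hXY, zero_lie])
  have hY : Y ≠ 0 := by
    rintro rfl
    exact hH (by rw [← hXY, lie_zero])
  rw [Fintype.linearIndependent_iff]
  intro g hg
  simp only [Fin.sum_univ_three, Matrix.cons_val] at hg
  have h_sub : g 0 • X - g 1 • Y = 0 := by
    apply cancel_two
    calc (2 : Λ) • (g 0 • X - g 1 • Y) = ⁅H, g 0 • X + g 1 • Y + g 2 • H⁆ := by
          simp only [lie_add, lie_smul, hHX, hHY, lie_self]
          module
      _ = 0 := by rw [hg, lie_zero]
  have h_add : g 0 • X + g 1 • Y = 0 := by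
    apply cancel_two
    calc (2 : Λ) • (g 0 • X + g 1 • Y) = ⁅H, g 0 • X - g 1 • Y⁆ := by
          simp only [lie_sub, lie_smul, hHX, hHY]
          module
      _ = 0 := by rw [h_sub, lie_zero]
  have h0 : g 0 = 0 := by
    refine (htf _ X (cancel_two ?_)).resolve_right hX
    linear_combination (norm := module) h_add + h_sub
  have h1 : g 1 = 0 := by
    refine (htf _ Y ?_).resolve_right hY
    simpa [h0] using h_add
  have h2' : g 2 = 0 := by
    refine (htf _ H ?_).resolve_right hH
    simpa [h0, h1] using hg
  intro i
  fin_cases i <;> assumption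
end

section
/- Let k be a field of characteristic p > 0 and V a finite-dimensional k-vector space. Let 𝔥 be a set of endomorphisms of V such that for every H ∈ 𝔥 there exists Z ∈ 𝔥 with Z^p = H (p-th power meaning p-fold composition). Let Y be an endomorphism of V commuting with every element of 𝔥 and satisfying tr(Y ∘ H) = 0 for all H ∈ 𝔥. Then also tr(Y^p ∘ H) = 0 for all H ∈ 𝔥. -/
open Polynomial in
/-- Over a commutative ring of prime characteristic `p`, the characteristic polynomial of `M ^ p`
is obtained from that of `M` by applying the Frobenius to the coefficients. -/
theorem Matrix.charpoly_pow_char {R n : Type*} [CommRing R] [Fintype n] [DecidableEq n]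
    (p : ℕ) [Fact p.Prime] [CharP R p] (M : Matrix n n R) :
    (M ^ p).charpoly = M.charpoly.map (frobenius R p) := by
  cases isEmpty_or_nonempty n
  · simp
  apply expand_injective (Fact.out : p.Prime).pos
  rw [← map_expand, map_frobenius_expand]
  unfold Matrix.charpoly
  rw [AlgHom.map_det, ← coe_detMonoidHom, ← (detMonoidHom : Matrix n n R[X] →* R[X]).map_pow]
  apply congr_arg det
  refine matPolyEquiv.injective ?_
  rw [map_pow, matPolyEquiv_charmatrix, sub_pow_char_of_commute _ (C M).commute_X, ← C_pow]
  exact matPolyEquiv_eq_X_pow_sub_C p M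

theorem Matrix.trace_pow_char {R n : Type*} [CommRing R] [Fintype n] [DecidableEq n]
    (p : ℕ) [Fact p.Prime] [CharP R p] (M : Matrix n n R) :
    (M ^ p).trace = M.trace ^ p := by
  have : Nontrivial R := CharP.nontrivial_of_char_ne_one (Fact.out : p.Prime).ne_one
  cases isEmpty_or_nonempty n
  · simp [Matrix.trace, (Fact.out : p.Prime).ne_zero]
  rw [trace_eq_neg_charpoly_coeff, charpoly_pow_char, Polynomial.coeff_map,
    trace_eq_neg_charpoly_coeff, ← frobenius_def, map_neg]

theorem LinearMap.trace_pow_char {R V : Type*} [CommRing R] [AddCommGroup V] [Module R V]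
    [Module.Free R V] [Module.Finite R V] (p : ℕ) [Fact p.Prime] [CharP R p]
    (f : Module.End R V) :
    LinearMap.trace R V (f ^ p) = LinearMap.trace R V f ^ p := by
  classical
  let b := Module.Free.chooseBasis R V
  rw [trace_eq_matrix_trace R b, trace_eq_matrix_trace R b, ← toMatrix_pow, Matrix.trace_pow_char]

/-- **Lemma (perp-p-power).**  Let `k` be a field of characteristic `p > 0` and `V` a
finite-dimensional `k`-vector space.  Let `𝔥` be a set of endomorphisms of `V` such that every
`H ∈ 𝔥` has a `p`-th root in `𝔥`.  If `Y` is an endomorphism of `V` commuting with every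
element of `𝔥` and satisfying `tr (Y ∘ H) = 0` for all `H ∈ 𝔥`, then also
`tr (Y ^ p ∘ H) = 0` for all `H ∈ 𝔥`. -/
theorem trace_pow_p_comp_eq_zero
    (p : ℕ) (hp : p.Prime) (k : Type*) [Field k] [CharP k p]
    (V : Type*) [AddCommGroup V] [Module k V] [FiniteDimensional k V]
    (𝔥 : Set (Module.End k V))
    (hroot : ∀ H ∈ 𝔥, ∃ Z ∈ 𝔥, Z ^ p = H)
    (Y : Module.End k V)
    (hcomm : ∀ H ∈ 𝔥, Commute Y H)
    (htr : ∀ H ∈ 𝔥, LinearMap.trace k V (Y * H) = 0) :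
    ∀ H ∈ 𝔥, LinearMap.trace k V (Y ^ p * H) = 0 := by
  have : Fact p.Prime := ⟨hp⟩
  intro H hH
  obtain ⟨Z, hZ, rfl⟩ := hroot H hH
  rw [← (hcomm Z hZ).mul_pow, LinearMap.trace_pow_char, htr Z hZ, zero_pow hp.ne_zero]
end

section
/- Let k be an algebraically closed field of characteristic p > 0, V a finite-dimensional k-vector space, and σ : V → V a bijective additive map satisfying σ(α v) = α^p σ(v) for all α ∈ k, v ∈ V. Let V^σ = {v ∈ V : σ(v) = v}, an 𝔽_p-subspace of V, and assume that the canonical k-linear map V^σ ⊗_{𝔽_p} k → V (induced by the inclusion V^σ ⊆ V) is bijective. Then for every k-subspace W ⊆ V, the following are equivalent: (a) σ(W) ⊆ W; (b) the canonical k-linear map (W ∩ V^σ) ⊗_{𝔽_p} k → W is bijective; equivalently, W is spanned over k by W ∩ V^σ. -/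
open TensorProduct

/-- A subspace stable under an additive map that is `p`-power semilinear and fixes a basis is
spanned by the fixed points it contains. -/
theorem mem_span_fixedPoints_of_stable {p : ℕ} [Fact p.Prime] {k V ι : Type*} [Field k] [CharP k p]
    [AddCommGroup V] [Module k V] {σ : V → V} (hadd : ∀ v w, σ (v + w) = σ v + σ w)
    (hsemi : ∀ (α : k) (v : V), σ (α • v) = α ^ p • σ v)
    (b : Module.Basis ι k V) (hb : ∀ i, σ (b i) = b i)
    {W : Submodule k V} (hW : ∀ w ∈ W, σ w ∈ W) {w : V} (hw : w ∈ W) :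
    w ∈ Submodule.span k ((W : Set V) ∩ {v | σ v = v}) := by
  have hp : p ≠ 0 := (Fact.out : p.Prime).ne_zero
  have hrepr : ∀ (v : V) (i : ι), b.repr (σ v) i = b.repr v i ^ p := by
    intro v
    have hv : v ∈ Submodule.span k (Set.range b) := by simp [b.span_eq]
    induction hv using Submodule.span_induction with
    | mem x hx =>
      obtain ⟨j, rfl⟩ := hx
      intro i
      classical
      rw [hb, b.repr_self, Finsupp.single_apply]
      split_ifs <;> simp [hp]
    | zero =>
      intro i
      have : σ 0 = 0 := by simpa using hadd 0 0
      simp [this, hp]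
    | add x y _ _ hx hy => intro i; simp [hadd, hx, hy, add_pow_char]
    | smul a x _ hx => intro i; simp [hsemi, hx, mul_pow]
  induction hn : (b.repr w).support.card using Nat.strong_induction_on generalizing w with
  | _ n ih =>
    subst hn
    have lt_of_support {v : V} {j : ι} (hsub : ∀ i, b.repr w i = 0 → b.repr v i = 0)
        (hj : b.repr w j ≠ 0) (hvj : b.repr v j = 0) :
        (b.repr v).support.card < (b.repr w).support.card := by
      refine Finset.card_lt_card (Finset.ssubset_iff_subset_ne.2 ⟨fun i hi => ?_, fun h => ?_⟩)
      · rw [Finsupp.mem_support_iff] at hi ⊢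
        exact mt (hsub i) hi
      · have : j ∈ (b.repr v).support := by rw [h]; simpa using hj
        simp [hvj] at this
    by_cases hex : ∃ v ∈ W, v ≠ 0 ∧ (∀ i, b.repr w i = 0 → b.repr v i = 0) ∧
        ∃ j, b.repr w j ≠ 0 ∧ b.repr v j = 0
    · obtain ⟨v, hv, hv0, hsub, j, hwj, hvj⟩ := hex
      obtain ⟨i, hi⟩ : ∃ i, b.repr v i ≠ 0 := by
        by_contra! h
        exact hv0 (b.repr.map_eq_zero_iff.1 (Finsupp.ext h))
      have hvU := ih _ (lt_of_support hsub hwj hvj) hv rfl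
      set c := b.repr w i / b.repr v i with hc
      have hdU := ih _ (lt_of_support (v := w - c • v) (j := i)
        (fun l hl => by simp [hl, hsub l hl]) (mt (hsub i) hi) (by simp [hc, hi]))
        (W.sub_mem hw (W.smul_mem c hv)) rfl
      simpa using Submodule.add_mem _ hdU (Submodule.smul_mem _ c hvU)
    · rcases eq_or_ne w 0 with rfl | hw0
      · exact Submodule.zero_mem _
      obtain ⟨j, hj⟩ : ∃ j, b.repr w j ≠ 0 := by
        by_contra! h
        exact hw0 (b.repr.map_eq_zero_iff.1 (Finsupp.ext h))
      set a := b.repr w j with ha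
      have hmem : a⁻¹ • w ∈ W := W.smul_mem _ hw
      have hfix : σ (a⁻¹ • w) = a⁻¹ • w := by
        by_contra hne
        exact hex ⟨σ (a⁻¹ • w) - a⁻¹ • w, W.sub_mem (hW _ hmem) hmem, sub_ne_zero.2 hne,
          fun i hi => by simp [hrepr, hi, hp], j, hj, by simp [hrepr, ← ha, hj]⟩
      have := Submodule.smul_mem _ a
        (Submodule.subset_span (R := k) (s := (W : Set V) ∩ {v | σ v = v}) ⟨hmem, hfix⟩)
      rwa [smul_inv_smul₀ hj] at this

/-- **Frobenius-semilinear descent (Borel AG 14.2).**  Let `k` be an algebraically closed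
field of characteristic `p > 0` (with its canonical `𝔽_p = ZMod p`-algebra structure), `V` a
finite-dimensional `k`-vector space, and `σ : V → V` a bijective additive map with
`σ (α • v) = α^p • σ v`.  Let `Vσ` be the `𝔽_p`-subspace of fixed points of `σ`, and assume
the canonical `k`-linear map `Vσ ⊗_{𝔽_p} k → V` is bijective.  Then a `k`-subspace `W ⊆ V`
is `σ`-stable if and only if `W` is spanned over `k` by `W ∩ Vσ` (equivalently, the canonical
map `(W ∩ Vσ) ⊗_{𝔽_p} k → W` is bijective). -/
theorem sigma_stable_iff_spanned_by_fixed_points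
    (p : ℕ) [Fact p.Prime] (k : Type*) [Field k] [IsAlgClosed k] [CharP k p]
    [Algebra (ZMod p) k]
    (V : Type*) [AddCommGroup V] [Module (ZMod p) V] [Module k V]
    [IsScalarTower (ZMod p) k V] [FiniteDimensional k V]
    (σ : V → V) (hbij : Function.Bijective σ)
    (hadd : ∀ v w : V, σ (v + w) = σ v + σ w)
    (hsemi : ∀ (α : k) (v : V), σ (α • v) = α ^ p • σ v)
    (Vσ : Submodule (ZMod p) V) (hVσ : (Vσ : Set V) = {v : V | σ v = v})
    (hcanonical : Function.Bijective (LinearMap.liftBaseChange k Vσ.subtype)) :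
    ∀ W : Submodule k V,
      (∀ w ∈ W, σ w ∈ W) ↔
        (W : Set V) = ↑(Submodule.span k ((W : Set V) ∩ {v : V | σ v = v})) := by
  intro W
  have h0 : σ 0 = 0 := by simpa using hadd 0 0
  constructor
  · intro hW
    have hspan : ⊤ ≤ Submodule.span k {v : V | σ v = v} := by
      intro v _
      obtain ⟨t, rfl⟩ := hcanonical.2 v
      induction t using TensorProduct.induction_on with
      | zero => simp
      | tmul a x =>
        rw [LinearMap.liftBaseChange_tmul]
        exact Submodule.smul_mem _ _ (Submodule.subset_span (hVσ ▸ x.2))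
      | add x y hx hy => rw [map_add]; exact Submodule.add_mem _ (hx trivial) (hy trivial)
    let b := Module.Basis.ofSpan hspan
    have hb : ∀ i, σ (b i) = b i := fun i =>
      Module.Basis.ofSpan_subset hspan (Set.mem_range_self i)
    exact Set.Subset.antisymm
      (fun w hw => mem_span_fixedPoints_of_stable hadd hsemi b hb hW hw)
      (SetLike.coe_subset_coe.2 (Submodule.span_le.2 Set.inter_subset_left))
  · intro hW w hw
    rw [← SetLike.mem_coe, hW, SetLike.mem_coe] at hw
    induction hw using Submodule.span_induction with
    | mem x hx => rw [hx.2]; exact hx.1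
    | zero => rw [h0]; exact W.zero_mem
    | add x y _ _ hx hy => rw [hadd]; exact W.add_mem hx hy
    | smul a x _ hx => rw [hsemi]; exact W.smul_mem _ hx
end

section
/- Let F be a field of characteristic 0 and V a finite-dimensional F-vector space. Let X, Y, H be endomorphisms of V, not all zero, with X and Y nilpotent, satisfying [X,Y] = H, [H,X] = 2X and [H,Y] = −2Y (where [A,B] = A∘B − B∘A). For a nilpotent endomorphism N, let exp(N) denote the finite sum Σ_{i ≥ 0} N^i / i!. Then there is a unique group homomorphism φ : SL(2, F) → GL(V) such that φ([[1, t],[0, 1]]) = exp(tX) and φ([[1, 0],[s, 1]]) = exp(sY) for all t, s ∈ F. -/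
/-- The exponential `exp N = Σ_{i ≥ 0} N^i / i!` of an endomorphism of a finite-dimensional
vector space in characteristic `0`; for a nilpotent `N` the series is the finite sum shown,
since `N ^ i = 0` for all `i > finrank F V`. -/
noncomputable def nilpExp (F : Type*) [Field F] (V : Type*) [AddCommGroup V] [Module F V]
    (N : Module.End F V) : Module.End F V :=
  ∑ i ∈ Finset.range (Module.finrank F V + 1), ((i.factorial : F)⁻¹) • N ^ i

namespace Matrix.SpecialLinearGroup

variable {F : Type*} [Field F]

/-- The upper unipotent matrix `[[1, t], [0, 1]]`. -/
def upperUnipotent (t : F) : SpecialLinearGroup (Fin 2) F :=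
  ⟨!![1, t; 0, 1], by simp [det_fin_two_of]⟩

/-- The lower unipotent matrix `[[1, 0], [s, 1]]`. -/
def lowerUnipotent (s : F) : SpecialLinearGroup (Fin 2) F :=
  ⟨!![1, 0; s, 1], by simp [det_fin_two_of]⟩

/-- The Weyl element `[[0, 1], [-1, 0]]`. -/
def weyl : SpecialLinearGroup (Fin 2) F :=
  ⟨!![0, 1; -1, 0], by simp [det_fin_two_of]⟩

@[simp]
lemma coe_upperUnipotent (t : F) : (upperUnipotent t).1 = !![1, t; 0, 1] := rfl

@[simp]
lemma coe_lowerUnipotent (s : F) : (lowerUnipotent s).1 = !![1, 0; s, 1] := rfl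

@[simp]
lemma coe_weyl : (weyl : SpecialLinearGroup (Fin 2) F).1 = !![0, 1; -1, 0] := rfl

/-- `SL(2, F)` is generated by its upper and lower unipotent subgroups. -/
lemma unipotent_induction {p : SpecialLinearGroup (Fin 2) F → Prop}
    (upper : ∀ t, p (upperUnipotent t)) (lower : ∀ s, p (lowerUnipotent s))
    (mul : ∀ g h, p g → p h → p (g * h)) (g : SpecialLinearGroup (Fin 2) F) : p g := by
  have key : ∀ g : SpecialLinearGroup (Fin 2) F, g.1 1 0 ≠ 0 → p g := by
    intro g hc
    have hdet : g.1 0 0 * g.1 1 1 - g.1 0 1 * g.1 1 0 = 1 := by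
      rw [← det_fin_two]; exact g.2
    have h := mul _ _ (mul _ _ (upper ((g.1 0 0 - 1) / g.1 1 0)) (lower (g.1 1 0)))
      (upper ((g.1 1 1 - 1) / g.1 1 0))
    convert h
    ext i j
    fin_cases i <;> fin_cases j <;> simp [mul_apply, Fin.sum_univ_two] <;> field_simp <;>
      first | ring1 | linear_combination -hdet
  by_cases hc : g.1 1 0 = 0
  · have hdet : g.1 0 0 * g.1 1 1 - g.1 0 1 * g.1 1 0 = 1 := by
      rw [← det_fin_two]; exact g.2
    have hd : g.1 1 1 ≠ 0 := by
      intro hd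
      simp [hc, hd] at hdet
    have h := mul _ _ (key (g * lowerUnipotent 1)
      (by simpa [mul_apply, Fin.sum_univ_two, hc] using hd)) (lower (-1))
    convert h
    ext i j
    fin_cases i <;> fin_cases j <;> simp [mul_apply, Fin.sum_univ_two]
  · exact key g hc

/-- The Weyl element `x(a) y(-a⁻¹) x(a)` attached to a pair of one-parameter families. -/
def weylElt {G : Type*} [Mul G] (x y : F → G) (a : F) : G :=
  x a * y (-a⁻¹) * x a

open scoped Classical in
/-- Steinberg's criterion: a pair of one-parameter subgroups of a group `G` satisfying the
Steinberg relations of type `A₁` comes from a homomorphism `SL(2, F) → G`. -/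
lemma exists_monoidHom_of_steinberg {G : Type*} [Group G] (x y : F → G)
    (hx : ∀ s t, x (s + t) = x s * x t) (hy : ∀ s t, y (s + t) = y s * y t)
    (hwx : ∀ a t, a ≠ 0 → weylElt x y a * x t = y (-(a⁻¹ ^ 2 * t)) * weylElt x y a)
    (hwy : ∀ a t, a ≠ 0 → weylElt x y a * y t = x (-(a ^ 2 * t)) * weylElt x y a)
    (hw : ∀ a b, a ≠ 0 → b ≠ 0 →
      weylElt x y (a * b) = weylElt x y a * (weylElt x y 1)⁻¹ * weylElt x y b) :
    ∃ φ : SpecialLinearGroup (Fin 2) F →* G, ∀ t : F,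
      φ (upperUnipotent t) = x t ∧ φ (lowerUnipotent t) = y t := by
  have hx0 : x 0 = 1 := by simpa using hx 0 0
  have hy0 : y 0 = 1 := by simpa using hy 0 0
  have hxneg : ∀ t, x (-t) = (x t)⁻¹ := fun t ↦ by
    rw [eq_inv_iff_mul_eq_one, ← hx, neg_add_cancel, hx0]
  have hyneg : ∀ t, y (-t) = (y t)⁻¹ := fun t ↦ by
    rw [eq_inv_iff_mul_eq_one, ← hy, neg_add_cancel, hy0]
  obtain ⟨w, hw1⟩ : ∃ w, w = weylElt x y 1 := ⟨_, rfl⟩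
  obtain ⟨τ, hτ⟩ : ∃ τ : F → G, ∀ a, τ a = weylElt x y a * w⁻¹ := ⟨_, fun _ ↦ rfl⟩
  have hwτ : ∀ a, weylElt x y a = τ a * w := fun a ↦ by simp [hτ]
  have hwx1 : ∀ t, w * x t = y (-t) * w := fun t ↦ by
    simpa [← hw1] using hwx 1 t one_ne_zero
  have hwy1 : ∀ t, w * y t = x (-t) * w := fun t ↦ by
    simpa [← hw1] using hwy 1 t one_ne_zero
  have hτmul : ∀ a b, a ≠ 0 → b ≠ 0 → τ (a * b) = τ a * τ b := fun a b ha hb ↦ by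
    simp only [hτ, hw a b ha hb, ← hw1, mul_assoc]
  have hτ1 : τ 1 = 1 := by simp [hτ, ← hw1]
  have hτx : ∀ a t, a ≠ 0 → τ a * x t = x (a ^ 2 * t) * τ a := fun a t ha ↦ by
    have h1 : w⁻¹ * x t = y (-t) * w⁻¹ := by
      rw [inv_mul_eq_iff_eq_mul, ← mul_assoc, hwy1, neg_neg, mul_inv_cancel_right]
    rw [hτ, mul_assoc, h1, ← mul_assoc, hwy a _ ha, mul_neg, neg_neg, mul_assoc]
  have hweyl_neg : ∀ a, weylElt x y (-a) = (weylElt x y a)⁻¹ := fun a ↦ by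
    simp [weylElt, hxneg, hyneg, inv_neg, mul_assoc]
  have hw2x : ∀ t, w * w * x t = x t * (w * w) := fun t ↦ by
    rw [mul_assoc, hwx1, ← mul_assoc, hwy1, neg_neg, mul_assoc]
  have hw2y : ∀ t, w * w * y t = y t * (w * w) := fun t ↦ by
    rw [mul_assoc, hwy1, ← mul_assoc, hwx1, neg_neg, mul_assoc]
  have hn1 : (-1 : F) ≠ 0 := by simp
  have hτn1' : τ (-1) = (w * w)⁻¹ := by
    rw [hτ, hweyl_neg, ← hw1, _root_.mul_inv_rev]
  have hτn1 : τ (-1) = w * w := by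
    have := hτmul (-1) (-1) hn1 hn1
    rw [neg_mul_neg, one_mul, hτ1] at this
    rw [eq_comm, ← inv_eq_iff_eq_inv.2 hτn1', eq_comm, eq_inv_iff_mul_eq_one, ← this]
  have hw2τ : ∀ a, Commute (w * w) (τ a) := fun a ↦ by
    have h1 : ∀ t, Commute (w * w) (x t) := hw2x
    have h2 : ∀ t, Commute (w * w) (y t) := hw2y
    have h3 : Commute (w * w) w := (Commute.refl w).mul_left (Commute.refl w)
    rw [hτ, weylElt]
    exact (((h1 _).mul_right (h2 _)).mul_right (h1 _)).mul_right h3.inv_right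
  have hwxw : ∀ s, s ≠ 0 →
      w * x s * w = x (-s⁻¹) * τ (-s⁻¹) * w * x (-s⁻¹) := fun s hs ↦ by
    have h1 : y (-s) = x (-s⁻¹) * weylElt x y s⁻¹ * x (-s⁻¹) := by
      simp [weylElt, hxneg, mul_assoc]
    have hsi := inv_ne_zero hs
    rw [hwx1, h1, hwτ, neg_eq_neg_one_mul s⁻¹, hτmul _ _ hn1 hsi, hτn1,
      mul_assoc _ w w, mul_assoc _ _ (w * w), ← hw2x, (hw2τ _).eq]
    simp only [mul_assoc]
  let f : SpecialLinearGroup (Fin 2) F → G := fun g ↦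
    if g.1 1 0 = 0 then x (g.1 0 0 * g.1 0 1) * τ (g.1 0 0)
    else x (g.1 0 0 / g.1 1 0) * τ (-(g.1 1 0)⁻¹) * w * x (g.1 1 1 / g.1 1 0)
  have hfx : ∀ g t, f (g * upperUnipotent t) = f g * x t := fun g t ↦ by
    have hdet : g.1 0 0 * g.1 1 1 - g.1 0 1 * g.1 1 0 = 1 := by
      rw [← det_fin_two]; exact g.2
    by_cases hc : g.1 1 0 = 0
    · have ha : g.1 0 0 ≠ 0 := by rintro ha; simp [ha, hc] at hdet
      simp only [f, coe_mul, coe_upperUnipotent, mul_apply, Fin.sum_univ_two]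
      simp [hc, mul_assoc, hτx _ t ha]
      rw [← mul_assoc, ← hx]
      ring_nf
    · simp only [f, coe_mul, coe_upperUnipotent, mul_apply, Fin.sum_univ_two]
      simp [hc, mul_assoc, ← hx]
      congr 4
      field_simp
      ring
  have hfw : ∀ g, f (g * weyl) = f g * w := fun g ↦ by
    have hdet : g.1 0 0 * g.1 1 1 - g.1 0 1 * g.1 1 0 = 1 := by
      rw [← det_fin_two]; exact g.2
    simp only [f, coe_mul, coe_weyl, mul_apply, Fin.sum_univ_two]
    generalize g.1 0 0 = a at *
    generalize g.1 0 1 = b at *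
    generalize g.1 1 0 = c at *
    generalize g.1 1 1 = d at *
    by_cases hc : c = 0
    · subst hc
      have ha : a ≠ 0 := by rintro rfl; simp at hdet
      have hd : d = a⁻¹ := by field_simp; linear_combination hdet
      subst hd
      simp [ha, hx0, mul_comm]
    · by_cases hd : d = 0
      · subst hd
        have hb : b = -c⁻¹ := by field_simp; linear_combination -hdet
        subst hb
        have : τ c⁻¹ = τ (-c⁻¹) * w * w := by
          rw [mul_assoc, ← hτn1, ← hτmul _ _ (by simpa) hn1]; simp
        simp [hc, hx0, mul_assoc, div_eq_mul_inv, mul_comm c⁻¹ a, this]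
      · have hs : d / c ≠ 0 := div_ne_zero hd hc
        have hb : b / d = a / c + (-c⁻¹) ^ 2 * (-(d / c)⁻¹) := by
          field_simp; linear_combination -hdet
        have ht : d⁻¹ = -c⁻¹ * -(d / c)⁻¹ := by field_simp
        have h1 := hwxw _ hs
        simp only [mul_assoc] at h1
        simp [hc, hd, mul_assoc, h1]
        rw [hb, ht, hx, hτmul _ _ (by simpa) (by simp [hc, hd]),
          ← mul_assoc (τ (-c⁻¹)), hτx _ _ (by simpa)]
        simp [mul_assoc, div_neg]
  have hf1 : f 1 = 1 := by simp [f, hx0, hτ1]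
  have hfgx : ∀ t, f (upperUnipotent t) = x t := fun t ↦ by simpa [hf1] using hfx 1 t
  have hfgw : f weyl = w := by simpa [hf1] using hfw 1
  have hfwinv : ∀ g, f (g * weyl⁻¹) = f g * w⁻¹ := fun g ↦ by
    rw [eq_mul_inv_iff_mul_eq, ← hfw, inv_mul_cancel_right]
  have hgy : ∀ t : F, lowerUnipotent t = weyl * upperUnipotent (-t) * weyl⁻¹ := fun t ↦ by
    rw [eq_mul_inv_iff_mul_eq]
    ext i j
    fin_cases i <;> fin_cases j <;> simp [mul_apply, Fin.sum_univ_two]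
  have hyw : ∀ t, y t = w * x (-t) * w⁻¹ := fun t ↦ by
    rw [hwx1, neg_neg, mul_inv_cancel_right]
  have hfy : ∀ g t, f (g * lowerUnipotent t) = f g * y t := fun g t ↦ by
    rw [hgy, hyw, ← mul_assoc, ← mul_assoc, hfwinv, hfx, hfw]
    simp only [mul_assoc]
  have hfgy : ∀ t, f (lowerUnipotent t) = y t := fun t ↦ by simpa [hf1] using hfy 1 t
  have hmul : ∀ h g, f (g * h) = f g * f h := by
    intro h
    induction h using unipotent_induction with
    | upper t => exact fun g ↦ (hfx g t).trans (by rw [← hfgx])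
    | lower t => exact fun g ↦ (hfy g t).trans (by rw [← hfgy])
    | mul h k hh hk => exact fun g ↦ by rw [← mul_assoc, hk, hh, hk, mul_assoc]
  exact ⟨⟨⟨f, hf1⟩, fun g h ↦ hmul h g⟩, fun t ↦ ⟨hfgx t, hfgy t⟩⟩

end Matrix.SpecialLinearGroup

open scoped Nat in
/-- If `[a, b] = c`, `[a, c] = 2d`, `[a, d] = 0` then `exp a` conjugates `b` to `b + c + d`. -/
lemma IsNilpotent.exp_mul_eq_of_lie {A : Type*} [Ring A] [Algebra ℚ A] {a b c d : A}
    (ha : IsNilpotent a) (hab : a * b = b * a + c) (hac : a * c = c * a + (2 : ℚ) • d)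
    (had : a * d = d * a) : exp a * b = (b + c + d) * exp a := by
  let e : ℕ → A := fun n ↦ (n ! : ℚ)⁻¹ • a ^ n
  have he : ∀ n : ℕ, a * e n = ((n : ℚ) + 1) • e (n + 1) := fun n ↦ by
    have : ((n : ℚ) + 1) ≠ 0 := by positivity
    simp only [e, mul_smul_comm, smul_smul, Nat.factorial_succ, pow_succ']
    push_cast
    congr 1
    field_simp
  have he0 : e 0 = 1 := by simp [e]
  have he1 : e 1 = a := by simp [e]
  have hstep : ∀ n, e (n + 2) * b = b * e (n + 2) + c * e (n + 1) + d * e n := by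
    intro n
    induction n with
    | zero =>
      have h2 : a * a = (2 : ℚ) • e 2 := by
        have := he 1
        rw [he1] at this
        rw [this]; norm_num
      have h : (2 : ℚ) • (e 2 * b) = (2 : ℚ) • (b * e 2 + c * e 1 + d * e 0) := by
        rw [← smul_mul_assoc, ← h2, mul_assoc, hab, mul_add, ← mul_assoc, hab, hac, add_mul,
          mul_assoc, h2, he0, he1]
        simp only [mul_smul_comm, mul_one]
        module
      exact smul_right_injective A (two_ne_zero' ℚ) h
    | succ n ih =>
      have hn : ((n : ℚ) + 3) ≠ 0 := by positivity
      have h3 := he (n + 2)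
      have h2 := he (n + 1)
      have h1 := he n
      push_cast at h3 h2
      have h : ((n : ℚ) + 3) • (e (n + 3) * b) =
          ((n : ℚ) + 3) • (b * e (n + 3) + c * e (n + 2) + d * e (n + 1)) := by
        have : ((n : ℚ) + 3) • e (n + 3) = a * e (n + 2) := by rw [h3]; congr 1; ring
        rw [← smul_mul_assoc, this, mul_assoc, ih, mul_add, mul_add, ← mul_assoc, ← mul_assoc,
          ← mul_assoc, hab, hac, had, add_mul, add_mul, mul_assoc, mul_assoc, mul_assoc,
          h1, h2, h3]
        simp only [mul_smul_comm, smul_mul_assoc]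
        module
      exact smul_right_injective A hn h
  obtain ⟨N, hN⟩ := ha
  have hs : ∀ m, N ≤ m → exp a = ∑ i ∈ Finset.range m, e i := fun m hm ↦
    exp_eq_sum (pow_eq_zero_of_le hm hN)
  rw [add_mul, add_mul]
  nth_rw 1 2 [hs (N + 2) (by omega)]
  nth_rw 1 [hs (N + 1) (by omega)]
  rw [hs N le_rfl]
  simp only [Finset.sum_range_succ' _ (N + 1), Finset.sum_range_succ' _ N, Finset.sum_mul,
    add_mul, add_assoc, one_add_one_eq_two, hstep, Finset.sum_add_distrib, mul_add, Finset.mul_sum]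
  simp only [zero_add, he0, he1, hab, mul_one, one_mul]
  abel

lemma SemiconjBy.exp_nilpotent {A : Type*} [Ring A] [Algebra ℚ A] {u a b : A}
    (h : SemiconjBy u a b) (ha : IsNilpotent a) (hb : IsNilpotent b) :
    SemiconjBy u (IsNilpotent.exp a) (IsNilpotent.exp b) := by
  obtain ⟨m, hm⟩ := ha
  obtain ⟨n, hn⟩ := hb
  rw [IsNilpotent.exp_eq_sum (pow_eq_zero_of_le (le_max_left m n) hm),
    IsNilpotent.exp_eq_sum (pow_eq_zero_of_le (le_max_right m n) hn)]
  simp only [SemiconjBy, Finset.mul_sum, Finset.sum_mul, mul_smul_comm, smul_mul_assoc,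
    (h.pow_right _).eq]

section Exponential

variable {F A : Type*} [Field F] [Ring A] [Algebra F A]

/-- If `w = ∑ W k` is invertible with `H * W k = k • W k = -W k * H`, then
`a ↦ (∑ a ^ k • W k) * w⁻¹` is multiplicative. -/
lemma weight_sum_mul [CharZero F] {H v : A} {s : Finset ℤ} {W : ℤ → A}
    (hHW : ∀ k ∈ s, H * W k = (k : F) • W k) (hWH : ∀ k ∈ s, W k * H = -(H * W k))
    (hv : (∑ k ∈ s, W k) * v = 1) (hv' : v * (∑ k ∈ s, W k) = 1) (a b : F) :
    (∑ k ∈ s, a ^ k • W k) * v * (∑ k ∈ s, b ^ k • W k) = ∑ k ∈ s, (a * b) ^ k • W k := by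
  have hwH : (∑ k ∈ s, W k) * H = -(H * ∑ k ∈ s, W k) := by
    rw [Finset.sum_mul, Finset.mul_sum, ← Finset.sum_neg_distrib]
    exact Finset.sum_congr rfl hWH
  have hvH : v * H = -(H * v) := by
    calc v * H = v * (H * ((∑ k ∈ s, W k) * v)) := by rw [hv, mul_one]
      _ = v * (-((∑ k ∈ s, W k) * H)) * v := by rw [hwH, neg_neg]; simp only [mul_assoc]
      _ = -(v * (∑ k ∈ s, W k) * (H * v)) := by simp only [mul_neg, neg_mul, mul_assoc]
      _ = _ := by rw [hv', one_mul]
  have h0 : ∀ k ∈ s, ∀ j ∈ s, k ≠ j → W k * v * W j = 0 := by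
    intro k hk j hj hkj
    have h1 : (k : F) • (W k * v * W j) = (j : F) • (W k * v * W j) := by
      rw [← smul_mul_assoc, ← smul_mul_assoc, ← hHW k hk, ← mul_smul_comm, ← hHW j hj, mul_assoc,
        mul_assoc, mul_assoc, ← mul_assoc v H, hvH, neg_mul, mul_neg, mul_assoc H,
        ← mul_assoc (W k) H, hWH k hk, neg_mul, neg_neg, mul_assoc]
    rw [← sub_eq_zero, ← sub_smul, smul_eq_zero, sub_eq_zero, Int.cast_inj] at h1
    exact h1.resolve_left hkj
  have h1 : ∀ j ∈ s, W j * v * W j = W j := by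
    intro j hj
    calc W j * v * W j = ∑ k ∈ s, W k * v * W j :=
          (Finset.sum_eq_single_of_mem j hj fun k hk hkj ↦ h0 k hk j hj hkj).symm
      _ = W j := by rw [← Finset.sum_mul, ← Finset.sum_mul, hv, one_mul]
  simp only [Finset.sum_mul, Finset.mul_sum]
  refine Finset.sum_congr rfl fun j hj ↦ ?_
  rw [Finset.sum_eq_single_of_mem j hj]
  · rw [smul_mul_assoc, smul_mul_assoc, mul_smul_comm, h1 j hj, smul_smul, mul_zpow]
  · intro k hk hkj
    rw [smul_mul_assoc, smul_mul_assoc, mul_smul_comm, h0 k hk j hj hkj, smul_zero, smul_zero]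

/-- Elements in distinct `ad H`-eigenspaces with zero sum vanish. -/
lemma eq_zero_of_sum_ad_eigenvector [CharZero F] {H : A} {s : Finset ℤ} {S : ℤ → A}
    (hS : ∀ k ∈ s, H * S k = S k * H + (2 * k : F) • S k) (h0 : ∑ k ∈ s, S k = 0) :
    ∀ k ∈ s, S k = 0 := by
  let f : Module.End F A := LinearMap.mulLeft F H - LinearMap.mulRight F H
  have hinj : Function.Injective fun k : ℤ ↦ (2 * k : F) := fun k l h ↦ by simpa using h
  have hind := f.eigenspaces_iSupIndep.comp hinj
  rw [iSupIndep_iff_finsetSum_eq_zero_imp_eq_zero] at hind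
  refine hind s S (fun k hk ↦ ?_) h0
  simp [f, hS k hk]

lemma ad_eigenvector_mul {H a b : A} {α β : F} (ha : H * a = a * H + α • a)
    (hb : H * b = b * H + β • b) : H * (a * b) = a * b * H + (α + β) • (a * b) := by
  rw [← mul_assoc, ha, add_mul, mul_assoc, hb, mul_add, smul_mul_assoc, mul_smul_comm, add_smul,
    mul_assoc]
  abel

lemma ad_eigenvector_pow {H a : A} {α : F} (ha : H * a = a * H + α • a) (n : ℕ) :
    H * a ^ n = a ^ n * H + (n * α) • a ^ n := by
  induction n with
  | zero => simp
  | succ n ih =>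
    rw [pow_succ, ad_eigenvector_mul ih ha]
    push_cast
    congr 2
    ring

lemma IsNilpotent.exp_eq_sum_inv_smul [Algebra ℚ A] {a : A} {n : ℕ} (h : a ^ n = 0) :
    exp a = ∑ i ∈ Finset.range n, (i.factorial : F)⁻¹ • a ^ i := by
  rw [exp_eq_sum h]
  exact Finset.sum_congr rfl fun i _ ↦ inv_natCast_smul_eq ℚ F _ _

variable [Algebra ℚ A]

open IsNilpotent

/-- The one-parameter subgroup `t ↦ exp (t • N)` of the unit group attached to a nilpotent `N`. -/
noncomputable def expUnit {N : A} (hN : IsNilpotent N) (t : F) : Aˣ where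
  val := exp (t • N)
  inv := exp (-(t • N))
  val_inv := exp_mul_exp_neg_self (hN.smul t)
  inv_val := exp_neg_mul_exp_self (hN.smul t)

lemma coe_expUnit {N : A} (hN : IsNilpotent N) (t : F) :
    (expUnit hN t : A) = exp (t • N) := rfl

lemma expUnit_add {N : A} (hN : IsNilpotent N) (s t : F) :
    expUnit hN (s + t) = expUnit hN s * expUnit hN t := by
  ext
  rw [Units.val_mul, coe_expUnit, coe_expUnit, coe_expUnit, add_smul]
  exact exp_add_of_commute (((Commute.refl N).smul_left s).smul_right t) (hN.smul s) (hN.smul t)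

variable [CharZero F] {X Y H : A}

/-- `exp(aX) exp(-a⁻¹Y) exp(aX)` is a Laurent polynomial in `a` whose coefficient of `a ^ k` has
`ad H`-weight `2k`. -/
lemma weyl_exp_decomposition (hX : IsNilpotent X) (hY : IsNilpotent Y)
    (hHX : H * X = X * H + (2 : F) • X) (hHY : H * Y = Y * H + (-2 : F) • Y) :
    ∃ (s : Finset ℤ) (W : ℤ → A), (∀ k, H * W k = W k * H + (2 * k : F) • W k) ∧
      ∀ a : F, a ≠ 0 → exp (a • X) * exp (-a⁻¹ • Y) * exp (a • X) = ∑ k ∈ s, a ^ k • W k := by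
  obtain ⟨m, hm⟩ := hX
  obtain ⟨n, hn⟩ := hY
  let I := Finset.range m ×ˢ Finset.range n ×ˢ Finset.range m
  let wt : ℕ × ℕ × ℕ → ℤ := fun p ↦ p.1 - p.2.1 + p.2.2
  let T : ℕ × ℕ × ℕ → A := fun p ↦
    ((p.1.factorial : F)⁻¹ * ((p.2.1.factorial : F)⁻¹ * (-1) ^ p.2.1) * (p.2.2.factorial : F)⁻¹) •
      (X ^ p.1 * Y ^ p.2.1 * X ^ p.2.2)
  refine ⟨I.image wt, fun k ↦ ∑ p ∈ I with wt p = k, T p, fun k ↦ ?_, fun a ha ↦ ?_⟩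
  · rw [Finset.mul_sum, Finset.sum_mul, Finset.smul_sum, ← Finset.sum_add_distrib]
    refine Finset.sum_congr rfl fun p hp ↦ ?_
    have h := ad_eigenvector_mul (ad_eigenvector_mul (ad_eigenvector_pow hHX p.1)
      (ad_eigenvector_pow hHY p.2.1)) (ad_eigenvector_pow hHX p.2.2)
    have hk : (2 * k : F) = p.1 * 2 + p.2.1 * (-2) + p.2.2 * 2 := by
      rw [← (Finset.mem_filter.1 hp).2]
      simp only [wt]
      push_cast
      ring
    simp only [T]
    rw [mul_smul_comm, h, hk, smul_add, smul_mul_assoc, smul_comm]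
  · have hXa : (a • X) ^ m = 0 := by rw [smul_pow, hm, smul_zero]
    have hYa : (-a⁻¹ • Y) ^ n = 0 := by rw [smul_pow, hn, smul_zero]
    have hterm : ∀ k, a ^ k • ∑ p ∈ I with wt p = k, T p =
        ∑ p ∈ I with wt p = k, a ^ wt p • T p := fun k ↦ by
      rw [Finset.smul_sum]
      exact Finset.sum_congr rfl fun p hp ↦ by rw [(Finset.mem_filter.1 hp).2]
    simp only [hterm]
    rw [Finset.sum_fiberwise_of_maps_to fun p hp ↦ Finset.mem_image_of_mem wt hp,
      exp_eq_sum_inv_smul (F := F) hXa, exp_eq_sum_inv_smul (F := F) hYa,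
      Finset.sum_product, Finset.sum_mul, Finset.sum_mul]
    refine Finset.sum_congr rfl fun i _ ↦ ?_
    simp only [Finset.mul_sum, Finset.sum_mul]
    rw [Finset.sum_product, Finset.sum_comm]
    refine Finset.sum_congr rfl fun j _ ↦ ?_
    refine Finset.sum_congr rfl fun l _ ↦ ?_
    simp only [T, wt, smul_pow, smul_mul_assoc, mul_smul_comm, smul_smul]
    congr 1
    rw [zpow_add₀ ha, zpow_sub₀ ha, neg_pow a⁻¹]
    simp only [zpow_natCast, inv_pow]
    field_simp

/-- Conjugation by `exp(aX) exp(-a⁻¹Y) exp(aX)` acts on an `sl₂`-triple as a Weyl element. -/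
lemma weyl_exp_conj (hX : IsNilpotent X) (hY : IsNilpotent Y)
    (hXY : X * Y = Y * X + H)
    (hHX : H * X = X * H + (2 : F) • X) (hHY : H * Y = Y * H + (-2 : F) • Y) {a : F} (ha : a ≠ 0) :
    exp (a • X) * exp (-a⁻¹ • Y) * exp (a • X) * X =
      (-(a⁻¹ ^ 2) • Y) * (exp (a • X) * exp (-a⁻¹ • Y) * exp (a • X)) ∧
    exp (a • X) * exp (-a⁻¹ • Y) * exp (a • X) * Y =
      (-(a ^ 2) • X) * (exp (a • X) * exp (-a⁻¹ • Y) * exp (a • X)) ∧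
    exp (a • X) * exp (-a⁻¹ • Y) * exp (a • X) * H =
      -(H * (exp (a • X) * exp (-a⁻¹ • Y) * exp (a • X))) := by
  have hXn : ∀ t : F, IsNilpotent (t • X) := fun t ↦ hX.smul t
  have hYn : ∀ t : F, IsNilpotent (t • Y) := fun t ↦ hY.smul t
  have q2 : ∀ z : A, (2 : ℚ) • z = (2 : F) • z := fun z ↦ by
    rw [two_smul, two_smul]
  have XX : ∀ t : F, exp (t • X) * X = X * exp (t • X) := fun t ↦ by
    simpa using exp_mul_eq_of_lie (c := 0) (d := 0) (hXn t) (b := X) (by simp) (by simp) (by simp)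
  have YY : ∀ t : F, exp (t • Y) * Y = Y * exp (t • Y) := fun t ↦ by
    simpa using exp_mul_eq_of_lie (c := 0) (d := 0) (hYn t) (b := Y) (by simp) (by simp) (by simp)
  have XH : ∀ t : F, exp (t • X) * H = (H + (-2 * t) • X) * exp (t • X) := fun t ↦ by
    simpa using exp_mul_eq_of_lie (c := (-2 * t) • X) (d := 0) (hXn t) (b := H)
      (by rw [mul_smul_comm, hHX, smul_mul_assoc]; module) (by simp [smul_smul, mul_comm])
      (by simp)
  have YH : ∀ t : F, exp (t • Y) * H = (H + (2 * t) • Y) * exp (t • Y) := fun t ↦ by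
    simpa using exp_mul_eq_of_lie (c := (2 * t) • Y) (d := 0) (hYn t) (b := H)
      (by rw [mul_smul_comm, hHY, smul_mul_assoc]; module) (by simp [smul_smul, mul_comm])
      (by simp)
  have XY : ∀ t : F, exp (t • X) * Y = (Y + t • H + (-t ^ 2) • X) * exp (t • X) := fun t ↦
    exp_mul_eq_of_lie (hXn t) (by rw [smul_mul_assoc, hXY, mul_smul_comm]; module)
      (by rw [q2]; simp only [mul_smul_comm, smul_mul_assoc, hHX]; module)
      (by simp [smul_smul, mul_comm])
  have YX : ∀ t : F, exp (t • Y) * X = (X + (-t) • H + (-t ^ 2) • Y) * exp (t • Y) := fun t ↦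
    exp_mul_eq_of_lie (hYn t) (by rw [mul_smul_comm, hXY, smul_mul_assoc]; module)
      (by rw [q2]; simp only [mul_smul_comm, smul_mul_assoc, hHY]; module)
      (by simp [smul_smul, mul_comm])
  have hE : ∀ α β γ : F, exp (a • X) * (α • X + β • H + γ • Y) =
      ((α - 2 * a * β - a ^ 2 * γ) • X + (β + a * γ) • H + γ • Y) * exp (a • X) := fun α β γ ↦ by
    simp only [mul_add, mul_smul_comm, XX, XH, XY, ← smul_mul_assoc, ← add_mul]
    congr 1
    module
  have hE' : ∀ α β γ : F, exp (-a⁻¹ • Y) * (α • X + β • H + γ • Y) =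
      (α • X + (β + a⁻¹ * α) • H + (γ - 2 * a⁻¹ * β - a⁻¹ ^ 2 * α) • Y) * exp (-a⁻¹ • Y) :=
    fun α β γ ↦ by
    simp only [mul_add, mul_smul_comm, YY, YH, YX, ← smul_mul_assoc, ← add_mul]
    congr 1
    module
  have hw : ∀ α β γ : F, exp (a • X) * exp (-a⁻¹ • Y) * exp (a • X) * (α • X + β • H + γ • Y) =
      ((-(a ^ 2) * γ) • X + (-β) • H + (-(a⁻¹ ^ 2) * α) • Y) *
        (exp (a • X) * exp (-a⁻¹ • Y) * exp (a • X)) := fun α β γ ↦ by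
    rw [mul_assoc, hE, mul_assoc, ← mul_assoc (exp (-a⁻¹ • Y)), hE', mul_assoc, ← mul_assoc, hE]
    simp only [mul_assoc]
    congr 1
    match_scalars <;> field_simp <;> ring
  refine ⟨?_, ?_, ?_⟩
  · simpa using hw 1 0 0
  · simpa using hw 0 0 1
  · simpa using hw 0 1 0

/-- With `w a = exp(aX) exp(-a⁻¹Y) exp(aX)`, the map `a ↦ w a * (w 1)⁻¹` is multiplicative. -/
lemma weyl_exp_mul (hX : IsNilpotent X) (hY : IsNilpotent Y) (hXY : X * Y = Y * X + H)
    (hHX : H * X = X * H + (2 : F) • X) (hHY : H * Y = Y * H + (-2 : F) • Y)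
    {w : F → A} (hw : ∀ a, w a = exp (a • X) * exp (-a⁻¹ • Y) * exp (a • X)) {v : A}
    (hv : w 1 * v = 1) (hv' : v * w 1 = 1) {a b : F} (ha : a ≠ 0) (hb : b ≠ 0) :
    w (a * b) = w a * v * w b := by
  obtain ⟨s, W, hW, hsum⟩ := weyl_exp_decomposition hX hY hHX hHY
  have hw1 : w 1 = ∑ k ∈ s, W k := by simpa [hw] using hsum 1 one_ne_zero
  have hwH : w 1 * H = -(H * w 1) := by
    rw [hw]
    exact (weyl_exp_conj hX hY hXY hHX hHY one_ne_zero).2.2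
  have hanti : ∀ k ∈ s, W k * H + H * W k = 0 := by
    refine eq_zero_of_sum_ad_eigenvector (F := F) (H := H) (fun k _ ↦ ?_) ?_
    · rw [hW k]
      simp only [mul_add, add_mul, ← mul_assoc, hW k, smul_mul_assoc, mul_smul_comm]
      module
    · rw [Finset.sum_add_distrib, ← Finset.sum_mul, ← Finset.mul_sum, ← hw1, hwH, neg_add_cancel]
  have hWH : ∀ k ∈ s, W k * H = -(H * W k) := fun k hk ↦ eq_neg_of_add_eq_zero_left (hanti k hk)
  have hHW : ∀ k ∈ s, H * W k = (k : F) • W k := fun k hk ↦ by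
    have h := hW k
    rw [hWH k hk, ← sub_eq_iff_eq_add', sub_neg_eq_add, ← two_smul F, mul_smul] at h
    exact smul_right_injective A (two_ne_zero' F) h
  rw [hw, hw a, hw b, hsum _ (mul_ne_zero ha hb), hsum a ha, hsum b hb]
  rw [hw1] at hv hv'
  exact (weight_sum_mul hHW hWH hv hv' a b).symm

open Matrix.SpecialLinearGroup

/-- An `sl₂`-triple with nilpotent `X` and `Y` in an associative algebra integrates to a
homomorphism from `SL(2, F)` to the unit group. -/
theorem exists_monoidHom_of_sl2_triple (hX : IsNilpotent X) (hY : IsNilpotent Y)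
    (hXY : X * Y = Y * X + H) (hHX : H * X = X * H + (2 : F) • X)
    (hHY : H * Y = Y * H + (-2 : F) • Y) :
    ∃ φ : Matrix.SpecialLinearGroup (Fin 2) F →* Aˣ, ∀ t : F,
      (φ (upperUnipotent t) : A) = exp (t • X) ∧ (φ (lowerUnipotent t) : A) = exp (t • Y) := by
  have hval : ∀ a : F, ((weylElt (expUnit hX) (expUnit hY) a : Aˣ) : A) =
      exp (a • X) * exp (-a⁻¹ • Y) * exp (a • X) := fun a ↦ by
    simp only [weylElt, Units.val_mul, coe_expUnit]
  obtain ⟨φ, hφ⟩ := exists_monoidHom_of_steinberg (F := F) (expUnit hX) (expUnit hY)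
    (expUnit_add hX) (expUnit_add hY)
    (fun a t ha ↦ by
      have h : SemiconjBy ((weylElt (expUnit hX) (expUnit hY) a : Aˣ) : A) (t • X)
          (-(a⁻¹ ^ 2 * t) • Y) := by
        rw [SemiconjBy, hval, mul_smul_comm, (weyl_exp_conj hX hY hXY hHX hHY ha).1,
          ← smul_mul_assoc, smul_smul, mul_neg, mul_comm t]
      exact Units.ext (h.exp_nilpotent (hX.smul _) (hY.smul _)))
    (fun a t ha ↦ by
      have h : SemiconjBy ((weylElt (expUnit hX) (expUnit hY) a : Aˣ) : A) (t • Y)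
          (-(a ^ 2 * t) • X) := by
        rw [SemiconjBy, hval, mul_smul_comm, (weyl_exp_conj hX hY hXY hHX hHY ha).2.1,
          ← smul_mul_assoc, smul_smul, mul_neg, mul_comm t]
      exact Units.ext (h.exp_nilpotent (hY.smul _) (hX.smul _)))
    (fun a b ha hb ↦ Units.ext <| by
      rw [Units.val_mul, Units.val_mul]
      exact weyl_exp_mul hX hY hXY hHX hHY
        (w := fun a ↦ ((weylElt (expUnit hX) (expUnit hY) a : Aˣ) : A)) hval
        (Units.mul_inv _) (Units.inv_mul _) ha hb)
  exact ⟨φ, fun t ↦ ⟨by rw [(hφ t).1, coe_expUnit], by rw [(hφ t).2, coe_expUnit]⟩⟩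

end Exponential

lemma IsNilpotent.pow_finrank_eq_zero {F V : Type*} [Field F] [AddCommGroup V] [Module F V]
    [FiniteDimensional F V] {N : Module.End F V} (hN : IsNilpotent N) :
    N ^ Module.finrank F V = 0 := by
  rw [← Polynomial.aeval_X_pow (R := F), ← hN.charpoly_eq_X_pow_finrank,
    LinearMap.aeval_self_charpoly]

lemma nilpExp_eq_exp {F V : Type*} [Field F] [AddCommGroup V] [Module F V]
    [FiniteDimensional F V] [Algebra ℚ (Module.End F V)] {N : Module.End F V}
    (hN : IsNilpotent N) : nilpExp F V N = IsNilpotent.exp N :=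
  (IsNilpotent.exp_eq_sum_inv_smul (by rw [pow_succ, hN.pow_finrank_eq_zero, zero_mul])).symm

/-- **Proposition (sl2-triple-char0) for `G = GL(V)`.**  Let `F` be a field of characteristic
`0` and `V` a finite-dimensional `F`-vector space.  Let `X, Y, H` be endomorphisms of `V`,
not all zero, with `X` and `Y` nilpotent, satisfying `[X,Y] = H`, `[H,X] = 2X`, `[H,Y] = -2Y`.
Then there is a unique group homomorphism `φ : SL(2,F) → GL(V)` with
`φ [[1,t],[0,1]] = exp (t • X)` and `φ [[1,0],[s,1]] = exp (s • Y)` for all `t, s ∈ F`. -/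
theorem sl2_triple_integrates
    (F : Type*) [Field F] [CharZero F]
    (V : Type*) [AddCommGroup V] [Module F V] [FiniteDimensional F V]
    (X Y H : Module.End F V)
    (hne : ¬(X = 0 ∧ Y = 0 ∧ H = 0))
    (hXnil : IsNilpotent X) (hYnil : IsNilpotent Y)
    (hXY : X * Y - Y * X = H)
    (hHX : H * X - X * H = (2 : F) • X)
    (hHY : H * Y - Y * H = -((2 : F) • Y)) :
    ∃! φ : Matrix.SpecialLinearGroup (Fin 2) F →* (Module.End F V)ˣ,
      ∀ t s : F,
        ((φ ⟨!![1, t; 0, 1], by simp [Matrix.det_fin_two_of]⟩ : (Module.End F V)ˣ) :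
            Module.End F V) = nilpExp F V (t • X) ∧
        ((φ ⟨!![1, 0; s, 1], by simp [Matrix.det_fin_two_of]⟩ : (Module.End F V)ˣ) :
            Module.End F V) = nilpExp F V (s • Y) := by
  let : Algebra ℚ (Module.End F V) := Algebra.compHom _ (algebraMap ℚ F)
  obtain ⟨φ, hφ⟩ := exists_monoidHom_of_sl2_triple (F := F) hXnil hYnil
    (eq_add_of_sub_eq' hXY) (eq_add_of_sub_eq' hHX)
    ((eq_add_of_sub_eq' hHY).trans (by rw [neg_smul]))
  refine ⟨φ, fun t s ↦ ⟨?_, ?_⟩, fun ψ hψ ↦ ?_⟩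
  · rw [nilpExp_eq_exp (hXnil.smul t)]
    exact (hφ t).1
  · rw [nilpExp_eq_exp (hYnil.smul s)]
    exact (hφ s).2
  · ext1 g
    induction g using Matrix.SpecialLinearGroup.unipotent_induction with
    | upper t =>
      refine Units.ext ?_
      rw [(hφ t).1, ← nilpExp_eq_exp (hXnil.smul t)]
      exact (hψ t 0).1
    | lower s =>
      refine Units.ext ?_
      rw [(hφ s).2, ← nilpExp_eq_exp (hYnil.smul s)]
      exact (hψ 0 s).2
    | mul g h hg hh => rw [map_mul, map_mul, hg, hh]
end
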